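/- arXiv:0802.2897 — 2 statements merged into one kernel-verified Lean document; each statement's English description precedes it below -/
import Mathlib

section
/- Let F be a differential field of characteristic zero with field of constants K, let A ∈ Mₙ(F), and let R and R' be Picard-Vessiot rings over F for the same matrix A. Then every homomorphism of differential F-algebras f : R → R' (a ring homomorphism over F commuting with the derivations) is bijective. -/
/-- `R` is a Picard-Vessiot ring over the differential field `F` (with derivation `dF` and
field of constants `K`) for the linear differential equation `∂w = A w`: it is a differential
ring extension of `F`, generated by a fundamental solution matrix `W` together with
`det W⁻¹` (equivalently by the entries of `W` and of `W⁻¹`), it is an integral domain, the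
field of constants of its fraction field is `K` (an element `x/y` of the fraction field is
constant iff `∂x · y = x · ∂y`, and it lies in `K` iff `x = c·y` for some `c ∈ K`), and it is
differentially simple. -/
structure IsPicardVessiotRing (K : Type*) [Field K] (F : Type*) [Field F] [Algebra K F]
    (R : Type*) [CommRing R] [Algebra F R]
    (dF : Derivation ℤ F F) (dR : Derivation ℤ R R)
    {n : ℕ} (A : Matrix (Fin n) (Fin n) F) : Prop where
  extends_deriv : ∀ f : F, dR (algebraMap F R f) = algebraMap F R (dF f)
  isDomain : IsDomain R
  exists_fundamental : ∃ W W' : Matrix (Fin n) (Fin n) R,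
    W * W' = 1 ∧ W' * W = 1 ∧
    (∀ i j, dR (W i j) = (A.map (algebraMap F R) * W) i j) ∧
    Algebra.adjoin F ({x | ∃ i j, W i j = x} ∪ {x | ∃ i j, W' i j = x}) = ⊤
  constants_fraction : ∀ x y : R, y ≠ 0 → dR x * y = x * dR y →
    ∃ c : K, x = algebraMap F R (algebraMap K F c) * y
  simple : ∀ I : Ideal R, (∀ x ∈ I, dR x ∈ I) → I = ⊥ ∨ I = ⊤

theorem Derivation.map_matrix_mul {S ι : Type*} [CommRing S] [Fintype ι]
    (d : Derivation ℤ S S) (M N : Matrix ι ι S) :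
    (M * N).map d = M.map d * N + M * N.map d := by
  ext i j
  simp only [Matrix.map_apply, Matrix.mul_apply, Matrix.add_apply, map_sum, Derivation.leibniz,
    smul_eq_mul, Finset.sum_add_distrib]
  rw [add_comm]
  congr 1
  exact Finset.sum_congr rfl fun _ _ => mul_comm _ _

theorem Derivation.map_matrix_one {S ι : Type*} [CommRing S] [DecidableEq ι]
    (d : Derivation ℤ S S) : (1 : Matrix ι ι S).map d = 0 := by
  ext i j
  by_cases h : i = j <;> simp [h]

/-- The quotient `W⁻¹ V` of two fundamental solution matrices of `∂w = B w` is constant. -/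
theorem Derivation.map_inv_mul_fundamental_eq_zero {S ι : Type*} [CommRing S] [Fintype ι]
    [DecidableEq ι] (d : Derivation ℤ S S) (B W W' V : Matrix ι ι S)
    (h₁ : W * W' = 1) (h₂ : W' * W = 1) (hW : W.map d = B * W) (hV : V.map d = B * V) :
    (W' * V).map d = 0 := by
  have h : W'.map d * W = -(W' * B * W) := by
    have := d.map_matrix_mul W' W
    rw [h₂, d.map_matrix_one, hW] at this
    rw [eq_neg_iff_add_eq_zero, Matrix.mul_assoc, ← this]
  have h' : W'.map d = -(W' * B) := by
    have := congrArg (· * W') h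
    simpa [Matrix.mul_assoc, h₁] using this
  rw [d.map_matrix_mul, h', hV, Matrix.neg_mul, Matrix.mul_assoc, neg_add_cancel]

/-- Any differential `F`-algebra homomorphism between two Picard-Vessiot
rings over `F` for the same matrix `A` is bijective. -/
theorem pvRing_algHom_bijective (K F R R' : Type*) [Field K] [Field F] [CharZero F]
    [Algebra K F] [CommRing R] [Algebra F R] [CommRing R'] [Algebra F R']
    (dF : Derivation ℤ F F) (dR : Derivation ℤ R R) (dR' : Derivation ℤ R' R')
    (hK : ∀ f : F, dF f = 0 ↔ f ∈ Set.range (algebraMap K F))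
    (n : ℕ) (A : Matrix (Fin n) (Fin n) F)
    (hR : IsPicardVessiotRing K F R dF dR A)
    (hR' : IsPicardVessiotRing K F R' dF dR' A)
    (f : R →ₐ[F] R') (hf : ∀ x : R, f (dR x) = dR' (f x)) :
    Function.Bijective f := by
  obtain ⟨W, W', hWW', hW'W, hdW, -⟩ := hR.exists_fundamental
  obtain ⟨V, V', hVV', hV'V, hdV, hgen⟩ := hR'.exists_fundamental
  have := hR'.isDomain
  constructor
  · rw [injective_iff_map_eq_zero]
    have hker : RingHom.ker f = ⊥ := by
      refine (hR.simple (RingHom.ker f) fun x hx => ?_).resolve_right (RingHom.ker_ne_top f)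
      rw [RingHom.mem_ker] at hx ⊢
      rw [hf, hx, map_zero]
    intro x hx
    have : x ∈ RingHom.ker f := hx
    rwa [hker, Ideal.mem_bot] at this
  · have h₁ : W.map f * W'.map f = 1 := by
      rw [← Matrix.map_mul, hWW', Matrix.map_one f (map_zero f) (map_one f)]
    have h₂ : W'.map f * W.map f = 1 := by
      rw [← Matrix.map_mul, hW'W, Matrix.map_one f (map_zero f) (map_one f)]
    have hfW : (W.map f).map dR' = A.map (algebraMap F R') * W.map f := by
      ext i j
      simp only [Matrix.map_apply]
      rw [← hf, hdW]
      simp [Matrix.mul_apply]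
    have hV : V.map dR' = A.map (algebraMap F R') * V := by
      ext i j
      exact hdV i j
    have hconst (M : Matrix (Fin n) (Fin n) R') (hM : M.map dR' = 0) (i j : Fin n) :
        M i j ∈ f.range := by
      have hij : dR' (M i j) = 0 := congrFun (congrFun hM i) j
      obtain ⟨c, hc⟩ := hR'.constants_fraction (M i j) 1 one_ne_zero (by simp [hij])
      rw [hc, mul_one]
      exact f.range.algebraMap_mem _
    have hC := hconst _ (dR'.map_inv_mul_fundamental_eq_zero _ V V' _ hVV' hV'V hV hfW)
    have hD := hconst _ (dR'.map_inv_mul_fundamental_eq_zero _ _ _ V h₁ h₂ hfW hV)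
    rw [← AlgHom.range_eq_top, eq_top_iff, ← hgen, Algebra.adjoin_le_iff]
    rintro x (⟨i, j, rfl⟩ | ⟨i, j, rfl⟩)
    · have hVeq : V = W.map f * (W'.map f * V) := by
        rw [← Matrix.mul_assoc, h₁, Matrix.one_mul]
      rw [hVeq, Matrix.mul_apply]
      exact sum_mem fun k _ => mul_mem ⟨W i k, rfl⟩ (hD k j)
    · have hVeq : V' = V' * W.map f * W'.map f := by
        rw [Matrix.mul_assoc, h₁, Matrix.mul_one]
      rw [hVeq, Matrix.mul_apply]
      exact sum_mem fun k _ => mul_mem (hC i k) ⟨W' k j, rfl⟩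
end

section
/- Let F be a differential field of characteristic zero whose field of constants K is algebraically closed, and let A ∈ Mₙ(F). Then any two Picard-Vessiot rings over F for A are isomorphic as differential F-algebras. -/
/-- Constants that are linearly independent over the field of constants `K` of a differentially
simple domain `R` remain linearly independent over `R`. -/
theorem LinearIndependent.of_constants {K R T ι : Type*} [Field K] [CommRing R] [IsDomain R]
    [CommRing T] [Algebra K R] [Algebra R T] [Algebra K T] [IsScalarTower K R T]
    (dR : Derivation ℤ R R) (dT : Derivation ℤ T T)
    (hd : ∀ r, dT (algebraMap R T r) = algebraMap R T (dR r))
    (hK : ∀ c : K, dR (algebraMap K R c) = 0)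
    (hfrac : ∀ x y : R, y ≠ 0 → dR x * y = x * dR y → ∃ c : K, x = algebraMap K R c * y)
    (hsimple : ∀ I : Ideal R, (∀ x ∈ I, dR x ∈ I) → I = ⊥ ∨ I = ⊤)
    {b : ι → T} (hb : ∀ i, dT (b i) = 0) (hli : LinearIndependent K b) :
    LinearIndependent R b := by
  classical
  have hann : ∀ (β : T) (r : R), dT β = 0 → r ≠ 0 → r • β = 0 → β = 0 := by
    intro β r hβ hr h
    rcases hsimple (LinearMap.ker (LinearMap.toSpanSingleton R T β)) (fun x hx => by
      simp only [LinearMap.mem_ker, LinearMap.toSpanSingleton_apply, Algebra.smul_def] at hx ⊢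
      simpa [hd, hβ, mul_comm] using congrArg dT hx) with h' | h'
    · exact absurd ((Submodule.mem_bot R).1 (h' ▸ (by simpa using h :
        r ∈ LinearMap.ker (LinearMap.toSpanSingleton R T β)))) hr
    · have : (1 : R) ∈ LinearMap.ker (LinearMap.toSpanSingleton R T β) := h' ▸ Submodule.mem_top
      simpa using this
  suffices H : ∀ (m : ℕ) (l : ι →₀ R), l.support.card ≤ m →
      Finsupp.linearCombination R b l = 0 → l = 0 from
    linearIndependent_iff.2 fun l hl => H _ l le_rfl hl
  intro m
  induction m with
  | zero => intro l hl _; simpa using hl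
  | succ m ih =>
    intro l hl h0
    by_contra hne
    obtain ⟨i₀, hi₀⟩ : ∃ i, l i ≠ 0 := by
      by_contra! h
      exact hne (Finsupp.ext h)
    set l' : ι →₀ R := l i₀ • l.mapRange dR (map_zero dR) - dR (l i₀) • l with hl'
    have hsum : Finsupp.linearCombination R b (l.mapRange dR (map_zero dR)) = 0 := by
      rw [Finsupp.linearCombination_apply,
        Finsupp.sum_of_support_subset _ Finsupp.support_mapRange _ (by simp)]
      have h1 := congrArg dT h0
      rw [Finsupp.linearCombination_apply, Finsupp.sum, map_sum, map_zero] at h1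
      rw [← h1]
      refine Finset.sum_congr rfl fun i _ => ?_
      simp [Algebra.smul_def, hd, hb, mul_comm]
    have hl'0 : l' = 0 := by
      refine ih l' ?_ (by simp [hl', hsum, h0])
      have hsub : l'.support ⊆ l.support.erase i₀ := by
        intro i hi
        rw [Finset.mem_erase, Finsupp.mem_support_iff]
        rw [Finsupp.mem_support_iff] at hi
        refine ⟨?_, ?_⟩
        · rintro rfl
          exact hi (by simp [hl', mul_comm])
        · intro h
          exact hi (by simp [hl', h])
      have := Finset.card_le_card hsub
      rw [Finset.card_erase_of_mem (Finsupp.mem_support_iff.2 hi₀)] at this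
      omega
    have hc : ∀ i, ∃ c : K, l i = algebraMap K R c * l i₀ := fun i => by
      refine hfrac _ _ hi₀ ?_
      have := DFunLike.congr_fun hl'0 i
      simp only [hl', Finsupp.sub_apply, Finsupp.smul_apply, Finsupp.mapRange_apply, smul_eq_mul,
        Finsupp.zero_apply] at this
      linear_combination this
    choose c hc using hc
    have hzero : ∑ i ∈ l.support, c i • b i = 0 := by
      refine hann _ (l i₀) ?_ hi₀ ?_
      · rw [map_sum]
        refine Finset.sum_eq_zero fun i _ => ?_
        simp [Algebra.smul_def, IsScalarTower.algebraMap_apply K R T, hd, hb, hK]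
      · rw [Finsupp.linearCombination_apply, Finsupp.sum] at h0
        rw [← h0, Finset.smul_sum]
        refine Finset.sum_congr rfl fun i _ => ?_
        rw [hc i, mul_comm, mul_smul, algebraMap_smul]
    have := linearIndependent_iff'.1 hli _ c hzero i₀ (Finsupp.mem_support_iff.2 hi₀)
    exact hi₀ (by rw [hc i₀, this]; simp)

/-- Over an algebraically closed field, every nontrivial algebra of finite type has an ideal
with residue field `K`. -/
theorem exists_ideal_residue_eq (K B : Type*) [Field K] [IsAlgClosed K] [CommRing B] [Nontrivial B]
    [Algebra K B] [Algebra.FiniteType K B] :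
    ∃ I : Ideal B, I ≠ ⊤ ∧ ∀ b : B, ∃ c : K, b - algebraMap K B c ∈ I := by
  obtain ⟨I, hI⟩ := Ideal.exists_maximal B
  let _ := Ideal.Quotient.field I
  have : Module.Finite K (B ⧸ I) := finite_of_finite_type_of_isJacobsonRing K (B ⧸ I)
  refine ⟨I, hI.ne_top, fun b => ?_⟩
  obtain ⟨c, hc⟩ := (IsAlgClosed.algebraMap_bijective_of_isIntegral (k := K) (K := B ⧸ I)).2
    (Ideal.Quotient.mk I b)
  exact ⟨c, Ideal.Quotient.eq.1 hc.symm⟩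

/-- If `T` is generated over a differentially simple domain `R` by finitely many constants, then
it has a proper differential ideal modulo which these constants lie in `K`. -/
theorem exists_differential_ideal {K R T : Type*} [Field K] [IsAlgClosed K] [CommRing R]
    [IsDomain R] [CommRing T] [Nontrivial T]
    [Algebra K R] [Algebra R T] [Algebra K T] [IsScalarTower K R T]
    (dR : Derivation ℤ R R) (dT : Derivation ℤ T T)
    (hd : ∀ r, dT (algebraMap R T r) = algebraMap R T (dR r))
    (hK : ∀ c : K, dR (algebraMap K R c) = 0)
    (hfrac : ∀ x y : R, y ≠ 0 → dR x * y = x * dR y → ∃ c : K, x = algebraMap K R c * y)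
    (hsimple : ∀ I : Ideal R, (∀ x ∈ I, dR x ∈ I) → I = ⊥ ∨ I = ⊤)
    {s : Set T} (hfin : s.Finite) (hs : ∀ x ∈ s, dT x = 0) (htop : Algebra.adjoin R s = ⊤) :
    ∃ J : Ideal T, (1 : T) ∉ J ∧ (∀ x ∈ J, dT x ∈ J) ∧
      ∀ x ∈ s, ∃ c : K, x - algebraMap K T c ∈ J := by
  have hKT : ∀ c : K, dT (algebraMap K T c) = 0 := fun c => by
    rw [IsScalarTower.algebraMap_apply K R T, hd, hK, map_zero]
  set B := Algebra.adjoin K s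
  have : Algebra.FiniteType K B := (Subalgebra.fg_iff_finiteType B).1
    (Subalgebra.fg_def.2 ⟨s, hfin, rfl⟩)
  have hconst : ∀ x ∈ B, dT x = 0 := fun x hx => by
    induction hx using Algebra.adjoin_induction with
    | mem x hx => exact hs x hx
    | algebraMap c => exact hKT c
    | add x y _ _ hx hy => simp [hx, hy]
    | mul x y _ _ hx hy => simp [hx, hy]
  obtain ⟨I, hI, hres⟩ := exists_ideal_residue_eq K B
  let N : Submodule K T := (I.restrictScalars K).map B.val.toLinearMap
  have hN : ∀ x : T, x ∈ N ↔ ∃ b ∈ I, (b : T) = x := fun x => Iff.rfl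
  have hNB : ∀ x ∈ N, x ∈ B := by
    rintro x hx
    obtain ⟨b, -, rfl⟩ := (hN x).1 hx
    exact b.2
  have hone : (1 : T) ∉ N := fun h => by
    obtain ⟨b, hb, h1⟩ := (hN 1).1 h
    exact hI ((Ideal.eq_top_iff_one I).2 ((Subtype.ext h1 : b = 1) ▸ hb))
  have hmul : ∀ (t x : T), x ∈ Submodule.span R (N : Set T) →
      t * x ∈ Submodule.span R (N : Set T) := by
    intro t x hx
    have ht : t ∈ Submodule.span R (B : Set T) := by
      have : t ∈ Subalgebra.toSubmodule (Algebra.adjoin R s) := by rw [htop]; trivial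
      rw [Algebra.adjoin_eq_span] at this
      exact Submodule.span_mono (Submonoid.closure_le (S := B.toSubmonoid).2
        Algebra.subset_adjoin) this
    have h := Submodule.mul_mem_mul ht hx
    rw [Submodule.span_mul_span] at h
    refine Submodule.span_mono ?_ h
    rintro _ ⟨b, hb, y, hy, rfl⟩
    obtain ⟨z, hz, rfl⟩ := (hN y).1 hy
    exact (hN _).2 ⟨⟨b, hb⟩ * z, I.mul_mem_left _ hz, rfl⟩
  have hspan : (1 : T) ∉ Submodule.span R (N : Set T) := by
    let v := Module.Basis.ofVectorSpace K N
    let w : _ → T := fun i => (v i : T)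
    have hw : LinearIndependent K w := v.linearIndependent.map' N.subtype (by simp)
    have hwspan : Submodule.span K (Set.range w) = N := by
      have := congrArg (Submodule.map N.subtype) v.span_eq
      rw [Submodule.map_span, ← Set.range_comp] at this
      simpa [w, Function.comp_def] using this
    have hopt : LinearIndependent K (fun o => Option.casesOn' o (1 : T) w) :=
      hw.option (by rwa [hwspan])
    have hR := LinearIndependent.of_constants dR dT hd hK hfrac hsimple (fun o => by
      cases o with
      | none => simp
      | some i => exact hconst _ (hNB _ (v i).2)) hopt
    intro h
    have hle : Submodule.span R (N : Set T) ≤ Submodule.span R (Set.range w) := by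
      rw [Submodule.span_le]
      exact hwspan.ge.trans (Submodule.span_le_restrictScalars K R _)
    have := hR.notMem_span_image (s := Set.range some) (x := none) (by simp)
    refine this ?_
    rw [← Set.range_comp]
    exact hle h
  let J : Ideal T :=
    { carrier := Submodule.span R (N : Set T)
      add_mem' := fun h h' => add_mem h h'
      zero_mem' := zero_mem _
      smul_mem' := fun t x hx => hmul t x hx }
  refine ⟨J, hspan, fun x hx => ?_, fun x hx => ?_⟩
  · change x ∈ Submodule.span R (N : Set T) at hx
    change dT x ∈ Submodule.span R (N : Set T)
    induction hx using Submodule.span_induction with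
    | mem x hx => rw [hconst x (hNB x hx)]; exact zero_mem _
    | zero => simp
    | add x y _ _ hx hy => rw [map_add]; exact add_mem hx hy
    | smul r x h hx =>
      rw [Algebra.smul_def, Derivation.leibniz, hd, smul_eq_mul, smul_eq_mul]
      refine add_mem (hmul _ _ hx) ?_
      rw [mul_comm, ← Algebra.smul_def]
      exact Submodule.smul_mem _ _ h
  · obtain ⟨c, hc⟩ := hres ⟨x, Algebra.subset_adjoin hx⟩
    exact ⟨c, Submodule.subset_span ((hN _).2 ⟨_, hc, rfl⟩)⟩

open scoped TensorProduct in
/-- The derivation `d ⊗ 1 + 1 ⊗ d'` on a tensor product of differential algebras. -/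
theorem exists_tensorProduct_derivation {F R R' : Type*} [CommRing F] [CommRing R] [Algebra F R]
    [CommRing R'] [Algebra F R'] (dF : Derivation ℤ F F) (dR : Derivation ℤ R R)
    (dR' : Derivation ℤ R' R')
    (h : ∀ f, dR (algebraMap F R f) = algebraMap F R (dF f))
    (h' : ∀ f, dR' (algebraMap F R' f) = algebraMap F R' (dF f)) :
    ∃ d : Derivation ℤ (R ⊗[F] R') (R ⊗[F] R'),
      ∀ x y, d (x ⊗ₜ y) = dR x ⊗ₜ y + x ⊗ₜ dR' y := by
  have hsmul : ∀ (f : F) (x : R), dR (f • x) = dF f • x + f • dR x := fun f x => by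
    simp only [Algebra.smul_def, Derivation.leibniz, h, Algebra.algebraMap_self_apply]; ring
  have hsmul' : ∀ (f : F) (x : R'), dR' (f • x) = dF f • x + f • dR' x := fun f x => by
    simp only [Algebra.smul_def, Derivation.leibniz, h', Algebra.algebraMap_self_apply]; ring
  let g : R →+ R' →+ R ⊗[F] R' :=
    AddMonoidHom.mk' (fun x => AddMonoidHom.mk' (fun y => dR x ⊗ₜ y + x ⊗ₜ dR' y)
      (fun y z => by simp only [map_add, TensorProduct.tmul_add]; abel))
      (fun x z => by
        ext y
        simp only [map_add, TensorProduct.add_tmul, AddMonoidHom.mk'_apply, AddMonoidHom.add_apply]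
        abel)
  let D : R ⊗[F] R' →+ R ⊗[F] R' := TensorProduct.liftAddHom g (fun f x y => by
    simp only [g, AddMonoidHom.mk'_apply, hsmul, hsmul', TensorProduct.add_tmul,
      TensorProduct.tmul_add, TensorProduct.smul_tmul]
    abel)
  have hD : ∀ x y, D (x ⊗ₜ y) = dR x ⊗ₜ y + x ⊗ₜ dR' y := fun x y => rfl
  refine ⟨Derivation.mk' D.toIntLinearMap fun a b => ?_, hD⟩
  change D (a * b) = a * D b + b * D a
  induction a using TensorProduct.induction_on with
  | zero => simp
  | add a a' ha ha' => rw [add_mul, map_add, ha, ha', map_add]; ring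
  | tmul x y =>
    induction b using TensorProduct.induction_on with
    | zero => simp
    | add b b' hb hb' => rw [mul_add, map_add, hb, hb', map_add]; ring
    | tmul z w =>
      simp only [Algebra.TensorProduct.tmul_mul_tmul, hD, Derivation.leibniz, smul_eq_mul, mul_add,
        TensorProduct.add_tmul, TensorProduct.tmul_add]
      rw [mul_comm z x, mul_comm w y, mul_comm z, mul_comm w]
      abel

/-- If `W` and `V` are solutions of `∂X = A X` and `W` is invertible, then `W⁻¹ V` is constant. -/
theorem Derivation.inv_mul_solution_eq_zero {T : Type*} [CommRing T] (d : Derivation ℤ T T) {n : ℕ}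
    {A W W' V : Matrix (Fin n) (Fin n) T} (h : W * W' = 1) (h' : W' * W = 1)
    (hW : W.map d = A * W) (hV : V.map d = A * V) : (W' * V).map d = 0 := by
  have hmul : ∀ M N : Matrix (Fin n) (Fin n) T,
      (M * N).map d = M.map d * N + M * N.map d := fun M N => by
    ext i j
    simp [Matrix.mul_apply, ← Finset.sum_add_distrib, mul_comm, add_comm]
  have hone : (1 : Matrix (Fin n) (Fin n) T).map d = 0 := by
    ext i j
    by_cases hij : i = j <;> simp [hij]
  have hW' : W'.map d = -(W' * A) := by
    have h1 : W'.map d * W + W' * (A * W) = 0 := by rw [← hW, ← hmul, h', hone]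
    have h2 := congrArg (· * W') h1
    simp only [add_mul, mul_assoc, h, mul_one, zero_mul] at h2
    exact eq_neg_of_add_eq_zero_left h2
  rw [hmul, hW', hV]
  noncomm_ring

theorem Subalgebra.matrix_mul_mem {F S : Type*} [CommRing F] [CommRing S] [Algebra F S]
    (P : Subalgebra F S) {n : ℕ} {M N : Matrix (Fin n) (Fin n) S}
    (hM : ∀ i j, M i j ∈ P) (hN : ∀ i j, N i j ∈ P) (i j : Fin n) : (M * N) i j ∈ P := by
  rw [Matrix.mul_apply]
  exact sum_mem fun k _ => mul_mem (hM i k) (hN k j)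

theorem AlgHom.range_le_of_matrix_generators {F R S : Type*} [CommRing F] [CommRing R] [CommRing S]
    [Algebra F R] [Algebra F S] {n : ℕ} {W W' : Matrix (Fin n) (Fin n) R}
    (h : Algebra.adjoin F ({x | ∃ i j, W i j = x} ∪ {x | ∃ i j, W' i j = x}) = ⊤)
    (φ : R →ₐ[F] S) {P : Subalgebra F S} (hW : ∀ i j, φ (W i j) ∈ P)
    (hW' : ∀ i j, φ (W' i j) ∈ P) : φ.range ≤ P := by
  rw [← Algebra.map_top, ← h, AlgHom.map_adjoin, Algebra.adjoin_le_iff]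
  rintro _ ⟨x, ⟨i, j, rfl⟩ | ⟨i, j, rfl⟩, rfl⟩
  exacts [hW i j, hW' i j]


/-- Two Picard-Vessiot rings for the same matrix that map into a common differential ring `T`
generated by their images are isomorphic. -/
theorem IsPicardVessiotRing.exists_algEquiv_of_amalgam {K F R R' T : Type*} [Field K]
    [IsAlgClosed K] [Field F] [Algebra K F]
    [CommRing R] [Algebra F R] [CommRing R'] [Algebra F R'] [CommRing T] [Nontrivial T]
    [Algebra F T] {dF : Derivation ℤ F F} {dR : Derivation ℤ R R} {dR' : Derivation ℤ R' R'}
    (hK : ∀ f : F, dF f = 0 ↔ f ∈ Set.range (algebraMap K F))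
    {n : ℕ} {A : Matrix (Fin n) (Fin n) F}
    (hR : IsPicardVessiotRing K F R dF dR A) (hR' : IsPicardVessiotRing K F R' dF dR' A)
    (d : Derivation ℤ T T) (ι₁ : R →ₐ[F] T) (ι₂ : R' →ₐ[F] T)
    (hd₁ : ∀ x, d (ι₁ x) = ι₁ (dR x)) (hd₂ : ∀ x, d (ι₂ x) = ι₂ (dR' x))
    (hgen : Algebra.adjoin F (Set.range ι₁ ∪ Set.range ι₂) = ⊤) :
    ∃ e : R ≃ₐ[F] R', ∀ x : R, e (dR x) = dR' (e x) := by
  have := hR.isDomain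
  obtain ⟨W, W', hWW', hW'W, hdW, hWgen⟩ := hR.exists_fundamental
  obtain ⟨V, V', hVV', hV'V, hdV, hVgen⟩ := hR'.exists_fundamental
  let _ : Algebra K R := Algebra.compHom R (algebraMap K F)
  let _ : Algebra K T := Algebra.compHom T (algebraMap K F)
  let _ : Algebra R T := ι₁.toRingHom.toAlgebra
  have hKFR : IsScalarTower K F R := .of_algebraMap_eq fun _ => rfl
  have hKRT : IsScalarTower K R T := .of_algebraMap_eq fun c => (ι₁.commutes _).symm
  have hdw : (W.map ι₁).map d = A.map (algebraMap F _) * W.map ι₁ := by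
    ext i j
    simp [hd₁, hdW, Matrix.mul_apply]
  have hdv : (V.map ι₂).map d = A.map (algebraMap F _) * V.map ι₂ := by
    ext i j
    simp only [Matrix.map_apply, hd₂, hdV, Matrix.mul_apply, map_sum, map_mul, AlgHom.commutes]
  have hmap₁ : ∀ {M N : Matrix (Fin n) (Fin n) R}, M * N = 1 → M.map ι₁ * N.map ι₁ = 1 :=
    fun {M N} h => by rw [← Matrix.map_mul, h, Matrix.map_one _ (map_zero _) (map_one _)]
  have hmap₂ : ∀ {M N : Matrix (Fin n) (Fin n) R'}, M * N = 1 → M.map ι₂ * N.map ι₂ = 1 :=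
    fun {M N} h => by rw [← Matrix.map_mul, h, Matrix.map_one _ (map_zero _) (map_one _)]
  set w := W.map ι₁
  set w' := W'.map ι₁
  set v := V.map ι₂
  set v' := V'.map ι₂
  have hww' : w * w' = 1 := hmap₁ hWW'
  have hw'w : w' * w = 1 := hmap₁ hW'W
  have hvv' : v * v' = 1 := hmap₂ hVV'
  have hv'v : v' * v = 1 := hmap₂ hV'V
  set Z := w' * v with hZ
  set Z' := v' * w with hZ'
  have hdZ : Z.map d = 0 := d.inv_mul_solution_eq_zero hww' hw'w hdw hdv
  have hdZ' : Z'.map d = 0 := d.inv_mul_solution_eq_zero hvv' hv'v hdv hdw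
  have hv_eq : v = w * Z := by rw [hZ, ← mul_assoc, hww', one_mul]
  have hw_eq : w = v * Z' := by rw [hZ', ← mul_assoc, hvv', one_mul]
  have hv'_eq : v' = Z' * w' := by rw [hZ', mul_assoc, hww', mul_one]
  have hw'_eq : w' = Z * v' := by rw [hZ, mul_assoc, hvv', mul_one]
  let s : Set T :=
    Set.range (fun p : Fin n × Fin n => Z p.1 p.2) ∪ Set.range fun p : Fin n × Fin n => Z' p.1 p.2
  have hsZ : ∀ i j, Z i j ∈ s := fun i j => .inl ⟨(i, j), rfl⟩
  have hsZ' : ∀ i j, Z' i j ∈ s := fun i j => .inr ⟨(i, j), rfl⟩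
  have htop : Algebra.adjoin R s = ⊤ := by
    obtain ⟨P, hι₁, hsP, hP⟩ : ∃ P : Subalgebra F T, (∀ x, ι₁ x ∈ P) ∧ (∀ x ∈ s, x ∈ P) ∧
        ∀ x ∈ P, x ∈ Algebra.adjoin R s :=
      ⟨(Algebra.adjoin R s).restrictScalars F, (Algebra.adjoin R s).algebraMap_mem,
        fun _ hx => Algebra.subset_adjoin (R := R) hx, fun _ hx => hx⟩
    have hι₂ : ∀ y, ι₂ y ∈ P := fun y =>
      ι₂.range_le_of_matrix_generators hVgen (P := P)
        (fun i j => by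
          change v i j ∈ P
          rw [hv_eq]
          exact P.matrix_mul_mem (fun _ _ => hι₁ _)
            (fun i j => hsP _ (hsZ i j)) i j)
        (fun i j => by
          change v' i j ∈ P
          rw [hv'_eq]
          exact P.matrix_mul_mem (fun i j => hsP _ (hsZ' i j))
            (fun _ _ => hι₁ _) i j) ⟨y, rfl⟩
    have hle : Algebra.adjoin F (Set.range ι₁ ∪ Set.range ι₂) ≤ P := by
      rw [Algebra.adjoin_le_iff]
      rintro _ (⟨x, rfl⟩ | ⟨y, rfl⟩)
      exacts [hι₁ x, hι₂ y]
    refine Algebra.eq_top_iff.2 fun t => hP t (hle ?_)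
    rw [hgen]
    trivial
  obtain ⟨J, hJ1, hJd, hJs⟩ := exists_differential_ideal (K := K) (R := R) dR d
    hd₁ (fun c => by
      rw [IsScalarTower.algebraMap_apply K F R, hR.extends_deriv, (hK _).2 ⟨c, rfl⟩, map_zero])
    hR.constants_fraction hR.simple
    (s := s) ((Set.finite_range _).union (Set.finite_range _))
    (by
      rintro _ (⟨p, rfl⟩ | ⟨p, rfl⟩)
      exacts [congrFun (congrFun hdZ p.1) p.2, congrFun (congrFun hdZ' p.1) p.2]) htop
  let π : T →ₐ[F] T ⧸ J := Ideal.Quotient.mkₐ F J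
  have hπ : ∀ x, π x = 0 ↔ x ∈ J := fun x => Ideal.Quotient.eq_zero_iff_mem
  let φ := π.comp ι₁
  let ψ := π.comp ι₂
  have hφ : Function.Injective φ := by
    refine (injective_iff_map_eq_zero φ).2 fun x hx => ?_
    rcases hR.simple (J.comap ι₁) (fun y hy => by
      rw [Ideal.mem_comap, ← hd₁]; exact hJd _ hy) with h | h
    · have : x ∈ J.comap ι₁ := (hπ _).1 hx
      rwa [h] at this
    · exact absurd (by simpa using (Ideal.eq_top_iff_one _).1 h) hJ1
  have hψ : Function.Injective ψ := by
    refine (injective_iff_map_eq_zero ψ).2 fun x hx => ?_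
    rcases hR'.simple (J.comap ι₂) (fun y hy => by
      rw [Ideal.mem_comap, ← hd₂]; exact hJd _ hy) with h | h
    · have : x ∈ J.comap ι₂ := (hπ _).1 hx
      rwa [h] at this
    · exact absurd (by simpa using (Ideal.eq_top_iff_one _).1 h) hJ1
  have hπs : ∀ (P : Subalgebra F (T ⧸ J)), ∀ x ∈ s, x ∈ P.comap π := fun P x hx => by
    obtain ⟨c, hc⟩ := hJs x hx
    rw [← hπ, map_sub, sub_eq_zero] at hc
    rw [Subalgebra.mem_comap, hc]
    exact (P.comap π).algebraMap_mem (algebraMap K F c)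
  have hrange : φ.range = ψ.range := by
    apply le_antisymm
    · set P := ψ.range.comap π
      have hι₂ : ∀ y, ι₂ y ∈ P := fun y => ⟨y, rfl⟩
      refine φ.range_le_of_matrix_generators hWgen (fun i j => ?_) (fun i j => ?_)
      · change w i j ∈ P
        rw [hw_eq]
        exact P.matrix_mul_mem (fun _ _ => hι₂ _) (fun i j => hπs _ _ (hsZ' i j)) i j
      · change w' i j ∈ P
        rw [hw'_eq]
        exact P.matrix_mul_mem (fun i j => hπs _ _ (hsZ i j)) (fun _ _ => hι₂ _) i j
    · set P := φ.range.comap π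
      have hι₁ : ∀ y, ι₁ y ∈ P := fun y => ⟨y, rfl⟩
      refine ψ.range_le_of_matrix_generators hVgen (fun i j => ?_) (fun i j => ?_)
      · change v i j ∈ P
        rw [hv_eq]
        exact P.matrix_mul_mem (fun _ _ => hι₁ _) (fun i j => hπs _ _ (hsZ i j)) i j
      · change v' i j ∈ P
        rw [hv'_eq]
        exact P.matrix_mul_mem (fun i j => hπs _ _ (hsZ' i j)) (fun _ _ => hι₁ _) i j
  let e : R ≃ₐ[F] R' := (AlgEquiv.ofInjective φ hφ).trans
    ((Subalgebra.equivOfEq _ _ hrange).trans (AlgEquiv.ofInjective ψ hψ).symm)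
  have he : ∀ x, ψ (e x) = φ x := fun x =>
    congrArg Subtype.val ((AlgEquiv.ofInjective ψ hψ).apply_symm_apply
      (Subalgebra.equivOfEq _ _ hrange (AlgEquiv.ofInjective φ hφ x)))
  refine ⟨e, fun x => hψ ?_⟩
  rw [he]
  have h1 : ι₁ x - ι₂ (e x) ∈ J := by
    rw [← hπ, map_sub, sub_eq_zero]
    exact (he x).symm
  have h2 := hJd _ h1
  rw [map_sub, hd₁, hd₂, ← hπ, map_sub, sub_eq_zero] at h2
  exact h2

/-- Over a differential field `F` of characteristic zero whose field of
constants `K` is algebraically closed, any two Picard-Vessiot rings for the same matrix `A`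
are isomorphic as differential `F`-algebras. -/
theorem pvRing_unique_of_isAlgClosed (K F R R' : Type*) [Field K] [IsAlgClosed K]
    [Field F] [CharZero F] [Algebra K F]
    [CommRing R] [Algebra F R] [CommRing R'] [Algebra F R']
    (dF : Derivation ℤ F F) (dR : Derivation ℤ R R) (dR' : Derivation ℤ R' R')
    (hK : ∀ f : F, dF f = 0 ↔ f ∈ Set.range (algebraMap K F))
    (n : ℕ) (A : Matrix (Fin n) (Fin n) F)
    (hR : IsPicardVessiotRing K F R dF dR A)
    (hR' : IsPicardVessiotRing K F R' dF dR' A) :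
    ∃ e : R ≃ₐ[F] R', ∀ x : R, e (dR x) = dR' (e x) := by
  have := hR.isDomain
  have := hR'.isDomain
  obtain ⟨d, hd⟩ := exists_tensorProduct_derivation dF dR dR' hR.extends_deriv hR'.extends_deriv
  refine hR.exists_algEquiv_of_amalgam hK hR' d Algebra.TensorProduct.includeLeft
    Algebra.TensorProduct.includeRight (fun x => (hd x 1).trans (by simp))
    (fun x => (hd 1 x).trans (by simp)) ?_
  refine Algebra.eq_top_iff.2 fun t => ?_
  induction t using TensorProduct.induction_on with
  | zero => exact zero_mem _
  | add a b ha hb => exact add_mem ha hb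
  | tmul x y =>
    have hx := Algebra.subset_adjoin (R := F) (s :=
      Set.range (Algebra.TensorProduct.includeLeft : R →ₐ[F] TensorProduct F R R') ∪
        Set.range (Algebra.TensorProduct.includeRight : R' →ₐ[F] TensorProduct F R R'))
    simpa using mul_mem (hx (.inl ⟨x, rfl⟩)) (hx (.inr ⟨y, rfl⟩))
end
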